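/- arXiv:2604.20894 — 2 statements merged into one kernel-verified Lean document; each statement's English description precedes it below -/
import Mathlib

section
/- Let B be a skew brace with an ideal J, let f : B → B/J be the canonical epimorphism with induced homomorphism f̄ : G_B → G_{B/J}, let I_J^f := ⟨ι(J)⟩_· · Ker f̄, and let π_B : G_B → B be the projection epimorphism. Then I_J := I_J^f · Ker π_B is an ideal of G_B and π_B(I_J) = J. -/
/-!
Common definitions: skew braces, set-theoretic solutions of the Yang–Baxter
equation, structure skew braces, ideals, i-homomorphisms, solubility.
-/

universe u v

/-- A skew (left) brace: two group structures `(B,+)` and `(B,·)` sharing the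
same identity `0`, with `a·(b+c) = a·b − a + a·c`. -/
structure SkewBrace (B : Type u) where
  add : B → B → B
  zero : B
  neg : B → B
  mul : B → B → B
  inv : B → B
  add_assoc : ∀ a b c, add (add a b) c = add a (add b c)
  zero_add : ∀ a, add zero a = a
  add_zero : ∀ a, add a zero = a
  neg_add : ∀ a, add (neg a) a = zero
  add_neg : ∀ a, add a (neg a) = zero
  mul_assoc : ∀ a b c, mul (mul a b) c = mul a (mul b c)
  zero_mul : ∀ a, mul zero a = a
  mul_zero : ∀ a, mul a zero = a
  inv_mul : ∀ a, mul (inv a) a = zero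
  mul_inv : ∀ a, mul a (inv a) = zero
  compat : ∀ a b c, mul a (add b c) = add (add (mul a b) (neg a)) (mul a c)

namespace SkewBrace

variable {B : Type u} (S : SkewBrace B)

/-- `λ_a(b) = −a + a·b`. -/
def lam (a b : B) : B := S.add (S.neg a) (S.mul a b)

/-- `ρ_b(a) = λ_a(b)⁻¹ · a · b`. -/
def rho (b a : B) : B := S.mul (S.mul (S.inv (S.lam a b)) a) b

/-- The solution of the YBE associated with a skew brace:
`r_B(a,b) = (λ_a(b), ρ_b(a))`. -/
def rB : B × B → B × B := fun p => (S.lam p.1 p.2, S.rho p.2 p.1)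

end SkewBrace

/-- Homomorphism of skew braces: preserves both operations. -/
def IsHom {B : Type u} {C : Type v} (S : SkewBrace B) (T : SkewBrace C) (f : B → C) : Prop :=
  (∀ a b, f (S.add a b) = T.add (f a) (f b)) ∧ (∀ a b, f (S.mul a b) = T.mul (f a) (f b))

/-- The kernel of a skew brace homomorphism: preimage of `0`. -/
def brKer {B : Type u} {C : Type v} (T : SkewBrace C) (f : B → C) : Set B :=
  {a | f a = T.zero}

/-- An ideal of a skew brace: a sub-skew brace, normal in both `(B,+)` and `(B,·)`,
and `λ_b`-invariant for all `b`. -/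
def IsIdeal {B : Type u} (S : SkewBrace B) (I : Set B) : Prop :=
  S.zero ∈ I ∧
  (∀ a ∈ I, ∀ b ∈ I, S.add a b ∈ I) ∧ (∀ a ∈ I, S.neg a ∈ I) ∧
  (∀ a ∈ I, ∀ b ∈ I, S.mul a b ∈ I) ∧ (∀ a ∈ I, S.inv a ∈ I) ∧
  (∀ b : B, ∀ a ∈ I, S.add (S.add b a) (S.neg b) ∈ I) ∧
  (∀ b : B, ∀ a ∈ I, S.mul (S.mul b a) (S.inv b) ∈ I) ∧
  (∀ b : B, S.lam b '' I = I)

/-- A skew brace is simple if it is non-trivial and its only ideals are `{0}` and `B`. -/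
def IsSimpleBrace {B : Type u} (S : SkewBrace B) : Prop :=
  (∃ a : B, a ≠ S.zero) ∧
  ∀ I : Set B, IsIdeal S I → I = {S.zero} ∨ I = Set.univ

/-- The socle of a skew brace: elements `a` with `λ_a = id` commuting additively
with everything. -/
def Soc {B : Type u} (S : SkewBrace B) : Set B :=
  {a | (∀ b, S.lam a b = b) ∧ (∀ b, S.add a b = S.add b a)}

/-- `r × id` on triples. -/
def rOne {X : Type u} (r : X × X → X × X) : X × X × X → X × X × X :=
  fun p => ((r (p.1, p.2.1)).1, (r (p.1, p.2.1)).2, p.2.2)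

/-- `id × r` on triples. -/
def rTwo {X : Type u} (r : X × X → X × X) : X × X × X → X × X × X :=
  fun p => (p.1, r p.2)

/-- `(X,r)` is a set-theoretic solution of the Yang–Baxter equation. -/
def IsSolution {X : Type u} (r : X × X → X × X) : Prop :=
  Function.Bijective r ∧
  rOne r ∘ rTwo r ∘ rOne r = rTwo r ∘ rOne r ∘ rTwo r

/-- `λ_x(y)` for a solution, i.e. the first component of `r(x,y)`. -/
def lamMap {X : Type u} (r : X × X → X × X) (x : X) : X → X := fun y => (r (x, y)).1

/-- `ρ_y(x)` for a solution, i.e. the second component of `r(x,y)`. -/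
def rhoMap {X : Type u} (r : X × X → X × X) (y : X) : X → X := fun x => (r (x, y)).2

/-- Non-degeneracy: all `λ_x` and `ρ_y` are bijective. -/
def Nondeg {X : Type u} (r : X × X → X × X) : Prop :=
  (∀ x, Function.Bijective (lamMap r x)) ∧ (∀ y, Function.Bijective (rhoMap r y))

/-- Homomorphism of solutions: `(f×f)∘r = s∘(f×f)`. -/
def IsSolHom {X : Type u} {Y : Type v} (r : X × X → X × X) (s : Y × Y → Y × Y)
    (f : X → Y) : Prop :=
  Prod.map f f ∘ r = s ∘ Prod.map f f

/-- The structure skew brace `(G_X, ι)` of a solution `(X,r)`: the image of `ι`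
generates `(G_X,·)`, `ι` intertwines `r` with `r_{G_X}`, and the pair has the
universal property for maps into skew braces. -/
structure StructureBrace {X : Type u} (r : X × X → X × X) where
  G : Type u
  S : SkewBrace G
  ι : X → G
  gen : ∀ H : Set G, S.zero ∈ H → (∀ a ∈ H, ∀ b ∈ H, S.mul a b ∈ H) →
      (∀ a ∈ H, S.inv a ∈ H) → Set.range ι ⊆ H → H = Set.univ
  compat : Prod.map ι ι ∘ r = S.rB ∘ Prod.map ι ι
  univ : ∀ {C : Type u} (T : SkewBrace C) (g : X → C),
      Prod.map g g ∘ r = T.rB ∘ Prod.map g g →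
      ∃! h : G → C, IsHom S T h ∧ h ∘ ι = g

/-- The multiplicative subgroup (as a set) generated by a subset. -/
def mulClosure {B : Type u} (S : SkewBrace B) (A : Set B) : Set B :=
  ⋂₀ {H : Set B | S.zero ∈ H ∧ (∀ a ∈ H, ∀ b ∈ H, S.mul a b ∈ H) ∧
      (∀ a ∈ H, S.inv a ∈ H) ∧ A ⊆ H}

/-- The additive subgroup (as a set) generated by a subset. -/
def addClosure {B : Type u} (S : SkewBrace B) (A : Set B) : Set B :=
  ⋂₀ {H : Set B | S.zero ∈ H ∧ (∀ a ∈ H, ∀ b ∈ H, S.add a b ∈ H) ∧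
      (∀ a ∈ H, S.neg a ∈ H) ∧ A ⊆ H}

/-- The ideal generated by a subset: intersection of all ideals containing it. -/
def idealClosure {B : Type u} (S : SkewBrace B) (A : Set B) : Set B :=
  ⋂₀ {I : Set B | IsIdeal S I ∧ A ⊆ I}

/-- Product of two subsets in the multiplicative group. -/
def setMul {B : Type u} (S : SkewBrace B) (A₁ A₂ : Set B) : Set B :=
  {c | ∃ a ∈ A₁, ∃ b ∈ A₂, c = S.mul a b}

/-- Sum of two subsets in the additive group. -/
def setAdd {B : Type u} (S : SkewBrace B) (A₁ A₂ : Set B) : Set B :=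
  {c | ∃ a ∈ A₁, ∃ b ∈ A₂, c = S.add a b}

/-- The multiplicative left coset `a·I`. -/
def lCoset {B : Type u} (S : SkewBrace B) (a : B) (I : Set B) : Set B :=
  (fun w => S.mul a w) '' I

/-- Equivalence class of the kernel relation of a map. -/
def kerClass {X : Type u} {Y : Type v} (f : X → Y) (x : X) : Set X := {z | f z = f x}

/-- `X₀` is an i-kernel of the homomorphism of solutions `f : (X,r) → (Y,s)`:
`f` is a homomorphism of solutions, `X₀` is an equivalence class of `ker f`, and
for every class `Z` of `ker f`, `r(X₀ × Z) = Z × X₀` and `r(Z × X₀) = X₀ × Z`.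
A homomorphism admitting such a class is an i-homomorphism. -/
def IsIKernel {X : Type u} {Y : Type v} (r : X × X → X × X) (s : Y × Y → Y × Y)
    (f : X → Y) (X₀ : Set X) : Prop :=
  IsSolHom r s f ∧ (∃ x : X, X₀ = kerClass f x) ∧
  ∀ z : X, r '' (X₀ ×ˢ kerClass f z) = (kerClass f z) ×ˢ X₀ ∧
           r '' ((kerClass f z) ×ˢ X₀) = X₀ ×ˢ (kerClass f z)

/-- A strong left ideal: a `λ`-invariant subgroup of `(B,+)` which is normal
in `(B,+)`. -/
def IsStrongLeftIdeal {B : Type u} (S : SkewBrace B) (I : Set B) : Prop :=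
  S.zero ∈ I ∧ (∀ a ∈ I, ∀ b ∈ I, S.add a b ∈ I) ∧ (∀ a ∈ I, S.neg a ∈ I) ∧
  (∀ b : B, S.lam b '' I = I) ∧
  (∀ b : B, ∀ a ∈ I, S.add (S.add b a) (S.neg b) ∈ I)

/-- An abelian ideal: an ideal on which the two operations coincide and are
commutative (so it is an abelian/trivial skew brace). -/
def IsAbelianIdeal {C : Type u} (T : SkewBrace C) (J : Set C) : Prop :=
  IsIdeal T J ∧ ∀ a ∈ J, ∀ b ∈ J, T.mul a b = T.add a b ∧ T.add a b = T.add b a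

/-- Solubility of a skew brace: epimorphisms `f_k : B → B_k`, `0 ≤ k ≤ t`, with
`Ker f_t = 0 ⊆ … ⊆ Ker f_0 = B` and `f_k(Ker f_{k−1})` an abelian ideal of `B_k`. -/
def IsSoluble {B : Type u} (S : SkewBrace B) : Prop :=
  ∃ (t : ℕ) (C : Fin (t + 1) → Type u) (T : ∀ k, SkewBrace (C k)) (f : ∀ k, B → C k),
    (∀ k, IsHom S (T k) (f k) ∧ Function.Surjective (f k)) ∧
    brKer (T (Fin.last t)) (f (Fin.last t)) = {S.zero} ∧
    brKer (T 0) (f 0) = Set.univ ∧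
    (∀ k : Fin t, brKer (T k.succ) (f k.succ) ⊆ brKer (T k.castSucc) (f k.castSucc)) ∧
    (∀ k : Fin t, IsAbelianIdeal (T k.succ) (f k.succ '' brKer (T k.castSucc) (f k.castSucc)))

/-- Solubility of a solution `(X,r)` (with structure skew brace `(G_X, ι)`):
there are skew braces `B_0,…,B_t`, i-epimorphisms `f_k : (X,r) → (B_k, r_{B_k})`
with i-kernels `X_k` for `0 ≤ k ≤ t−1`, and an epimorphism `f_t`, such that
`ker f_k ⊆ ker f_{k−1}`, `ker f_0` is total, `ker f_t ⊆ ker ι`, and each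
`f_k(X_{k−1})` lies in an abelian ideal `J` of `B_k` with `f_k(x)·J = f_k(y)·J`
whenever `x (ker f_{k−1}) y`. -/
def IsSolubleSolution {X : Type u} (r : X × X → X × X) (GX : StructureBrace r) : Prop :=
  ∃ (t : ℕ) (C : Fin (t + 1) → Type u) (T : ∀ k, SkewBrace (C k))
    (f : ∀ k : Fin (t + 1), X → C k) (Xk : Fin t → Set X),
    (∀ k : Fin (t + 1), IsSolHom r (T k).rB (f k) ∧ Function.Surjective (f k)) ∧
    (∀ k : Fin t, IsIKernel r (T k.castSucc).rB (f k.castSucc) (Xk k)) ∧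
    (∀ x y : X, f 0 x = f 0 y) ∧
    (∀ k : Fin t, ∀ x y : X, f k.succ x = f k.succ y → f k.castSucc x = f k.castSucc y) ∧
    (∀ x y : X, f (Fin.last t) x = f (Fin.last t) y → GX.ι x = GX.ι y) ∧
    (∀ k : Fin t, ∃ J : Set (C k.succ), IsAbelianIdeal (T k.succ) J ∧
      f k.succ '' (Xk k) ⊆ J ∧
      ∀ x y : X, f k.castSucc x = f k.castSucc y →
        lCoset (T k.succ) (f k.succ x) J = lCoset (T k.succ) (f k.succ y) J)

/-- Decomposability of a solution: `X = Y ∪ Z` with `Y, Z` proper and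
`r(Y×Y) = Y×Y`, `r(Z×Z) = Z×Z`. -/
def Decomposable {X : Type u} (r : X × X → X × X) : Prop :=
  ∃ Y Z : Set X, Y ≠ Set.univ ∧ Z ≠ Set.univ ∧ Y ∪ Z = Set.univ ∧
    r '' (Y ×ˢ Y) = Y ×ˢ Y ∧ r '' (Z ×ˢ Z) = Z ×ˢ Z

namespace SkewBrace

variable {B : Type u} (S : SkewBrace B)

theorem neg_add_cancel_left (a b : B) : S.add (S.neg a) (S.add a b) = b := by
  rw [← S.add_assoc, S.neg_add, S.zero_add]

theorem mul_inv_cancel_left (a b : B) : S.mul a (S.mul (S.inv a) b) = b := by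
  rw [← S.mul_assoc, S.mul_inv, S.zero_mul]

theorem inv_mul_cancel_left (a b : B) : S.mul (S.inv a) (S.mul a b) = b := by
  rw [← S.mul_assoc, S.inv_mul, S.zero_mul]

theorem neg_zero : S.neg S.zero = S.zero := by
  rw [← S.zero_add (S.neg S.zero), S.add_neg]

theorem inv_zero : S.inv S.zero = S.zero := by
  rw [← S.zero_mul (S.inv S.zero), S.mul_inv]

end SkewBrace

namespace IsHom

variable {B : Type u} {C : Type v} {S : SkewBrace B} {T : SkewBrace C} {f : B → C}

theorem map_zero (hf : IsHom S T f) : f S.zero = T.zero := by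
  rw [← T.neg_add_cancel_left (f S.zero) (f S.zero), ← hf.1, S.zero_add, T.neg_add]

theorem map_neg (hf : IsHom S T f) (a : B) : f (S.neg a) = T.neg (f a) := by
  rw [← T.neg_add_cancel_left (f a) (f (S.neg a)), ← hf.1, S.add_neg, hf.map_zero, T.add_zero]

theorem map_inv (hf : IsHom S T f) (a : B) : f (S.inv a) = T.inv (f a) := by
  rw [← T.inv_mul_cancel_left (f a) (f (S.inv a)), ← hf.2, S.mul_inv, hf.map_zero, T.mul_zero]

theorem map_lam (hf : IsHom S T f) (a b : B) : f (S.lam a b) = T.lam (f a) (f b) := by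
  simp only [SkewBrace.lam, hf.1, hf.2, hf.map_neg]

theorem comp {D : Type*} {U : SkewBrace D} {g : C → D} (hg : IsHom T U g) (hf : IsHom S T f) :
    IsHom S U (g ∘ f) :=
  ⟨fun a b => by simp only [Function.comp_apply, hf.1, hg.1],
    fun a b => by simp only [Function.comp_apply, hf.2, hg.2]⟩

theorem isIdeal_brKer (hf : IsHom S T f) : IsIdeal S (brKer T f) := by
  simp only [IsIdeal, brKer, Set.mem_ofPred_eq]
  refine ⟨hf.map_zero, fun a ha b hb => ?_, fun a ha => ?_, fun a ha b hb => ?_, fun a ha => ?_,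
    fun b a ha => ?_, fun b a ha => ?_, fun b => Set.Subset.antisymm ?_ fun x hx => ?_⟩
  · rw [hf.1, ha, hb, T.add_zero]
  · rw [hf.map_neg, ha, T.neg_zero]
  · rw [hf.2, ha, hb, T.mul_zero]
  · rw [hf.map_inv, ha, T.inv_zero]
  · rw [hf.1, hf.1, ha, hf.map_neg, T.add_zero, T.add_neg]
  · rw [hf.2, hf.2, ha, hf.map_inv, T.mul_zero, T.mul_inv]
  · rintro _ ⟨a, ha, rfl⟩
    change f (S.lam b a) = T.zero
    rw [hf.map_lam, show f a = T.zero from ha, SkewBrace.lam, T.mul_zero, T.neg_add]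
  · refine ⟨S.mul (S.inv b) (S.add b x), ?_, ?_⟩
    · change f _ = T.zero
      rw [hf.2, hf.1, show f x = T.zero from hx, hf.map_inv, T.add_zero, T.inv_mul]
    · rw [SkewBrace.lam, S.mul_inv_cancel_left, S.neg_add_cancel_left]

end IsHom

/-- Two homomorphisms out of the structure skew brace that agree on the image of `ι` are equal. -/
theorem StructureBrace.hom_ext {X : Type u} {r : X × X → X × X} (G : StructureBrace r)
    {C : Type v} {T : SkewBrace C} {g h : G.G → C} (hg : IsHom G.S T g) (hh : IsHom G.S T h)
    (hgh : ∀ x, g (G.ι x) = h (G.ι x)) : g = h := by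
  have key : {a | g a = h a} = Set.univ := by
    refine G.gen _ ?_ (fun a ha b hb => ?_) (fun a ha => ?_) ?_
    · exact hg.map_zero.trans hh.map_zero.symm
    · exact (hg.2 a b).trans ((congrArg₂ T.mul ha hb).trans (hh.2 a b).symm)
    · exact (hg.map_inv a).trans ((congrArg T.inv ha).trans (hh.map_inv a).symm)
    · rintro _ ⟨x, rfl⟩
      exact hgh x
  exact funext fun a => Set.eq_univ_iff_forall.1 key a

/-- The projection `G_B → B` exists. -/
theorem StructureBrace.exists_projection {B : Type u} {S : SkewBrace B}
    (G : StructureBrace S.rB) : ∃ p : G.G → B, IsHom G.S S p ∧ p ∘ G.ι = id :=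
  (G.univ S id (by simp)).exists

/-- With `I_J^f = ⟨ι(J)⟩_· · Ker f̄` and the projection
epimorphism `π_B : G_B → B`, the set `I_J = I_J^f · Ker π_B` is an ideal of
`G_B` with `π_B(I_J) = J`. -/
theorem stmt_15 {B : Type u} (S : SkewBrace B) (J : Set B) (hJ : IsIdeal S J)
    {Q : Type u} (TQ : SkewBrace Q) (f : B → Q) (hf : IsHom S TQ f)
    (hfs : Function.Surjective f) (hker : brKer TQ f = J)
    (GB : StructureBrace S.rB) (GQ : StructureBrace TQ.rB)
    (fbar : GB.G → GQ.G) (hfb : IsHom GB.S GQ.S fbar)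
    (hcomm : fbar ∘ GB.ι = GQ.ι ∘ f)
    (π : GB.G → B) (hπ : IsHom GB.S S π) (hπι : π ∘ GB.ι = id) :
    IsIdeal GB.S
      (setMul GB.S (setMul GB.S (mulClosure GB.S (GB.ι '' J)) (brKer GQ.S fbar))
        (brKer S π)) ∧
    π '' (setMul GB.S (setMul GB.S (mulClosure GB.S (GB.ι '' J)) (brKer GQ.S fbar))
        (brKer S π)) = J := by
  obtain ⟨p, hp, hpι⟩ := GQ.exists_projection
  have hF : IsHom GB.S TQ (f ∘ π) := hf.comp hπ
  have hsq : f ∘ π = p ∘ fbar := by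
    refine GB.hom_ext hF (hp.comp hfb) fun x => ?_
    have h₁ : π (GB.ι x) = x := congrFun hπι x
    have h₂ : fbar (GB.ι x) = GQ.ι (f x) := congrFun hcomm x
    have h₃ : p (GQ.ι (f x)) = f x := congrFun hpι (f x)
    simp only [Function.comp_apply, h₁, h₂, h₃]
  have hmemJ : ∀ j, j ∈ J ↔ f j = TQ.zero := fun j => by rw [← hker]; rfl
  have hpre : setMul GB.S (setMul GB.S (mulClosure GB.S (GB.ι '' J)) (brKer GQ.S fbar))
      (brKer S π) = brKer TQ (f ∘ π) := by
    obtain ⟨h0, -, -, hmul, hinv, -⟩ := hF.isIdeal_brKer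
    refine Set.Subset.antisymm ?_ fun g hg => ?_
    · rintro _ ⟨_, ⟨a, ha, b, hb, rfl⟩, c, hc, rfl⟩
      refine hmul _ (hmul _ ?_ _ ?_) _ ?_
      · refine ha (brKer TQ (f ∘ π)) ⟨h0, hmul, hinv, ?_⟩
        rintro _ ⟨j, hj, rfl⟩
        change f (π (GB.ι j)) = TQ.zero
        rw [show π (GB.ι j) = j from congrFun hπι j]
        exact (hmemJ j).1 hj
      · change (f ∘ π) b = TQ.zero
        rw [hsq, Function.comp_apply, show fbar b = GQ.S.zero from hb, hp.map_zero]
      · change f (π c) = TQ.zero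
        rw [show π c = S.zero from hc, hf.map_zero]
    · have hj : π g ∈ J := (hmemJ _).2 hg
      refine ⟨GB.ι (π g), ⟨GB.ι (π g), ?_, GB.S.zero, hfb.map_zero, (GB.S.mul_zero _).symm⟩,
        GB.S.mul (GB.S.inv (GB.ι (π g))) g, ?_, (GB.S.mul_inv_cancel_left _ _).symm⟩
      · rintro H ⟨-, -, -, hH⟩
        exact hH ⟨_, hj, rfl⟩
      · change π _ = S.zero
        rw [hπ.2, hπ.map_inv, show π (GB.ι (π g)) = π g from congrFun hπι (π g), S.inv_mul]
  rw [hpre]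
  refine ⟨hF.isIdeal_brKer, Set.Subset.antisymm ?_ fun j hj => ?_⟩
  · rintro _ ⟨g, hg, rfl⟩
    exact (hmemJ _).2 hg
  · have h : π (GB.ι j) = j := congrFun hπι j
    refine ⟨GB.ι j, ?_, h⟩
    change f (π (GB.ι j)) = TQ.zero
    rw [h]
    exact (hmemJ j).1 hj
end

section
/- Let (X,r) be a soluble non-degenerate solution of the Yang–Baxter equation. Then its structure skew brace G_X is a soluble skew brace. -/
/-!
Common definitions: skew braces, set-theoretic solutions of the Yang–Baxter
equation, structure skew braces, ideals, i-homomorphisms, solubility.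
-/

universe u v

namespace SkewBrace

variable {B : Type u} (S : SkewBrace B)

/-- The opposite skew brace, with reversed addition; its `λ`-map is `b ↦ a·b − a`. -/
def op : SkewBrace B where
  add a b := S.add b a
  zero := S.zero
  neg := S.neg
  mul := S.mul
  inv := S.inv
  add_assoc a b c := (S.add_assoc c b a).symm
  zero_add := S.add_zero
  add_zero := S.zero_add
  neg_add := S.add_neg
  add_neg := S.neg_add
  mul_assoc := S.mul_assoc
  zero_mul := S.zero_mul
  mul_zero := S.mul_zero
  inv_mul := S.inv_mul
  mul_inv := S.mul_inv
  compat a b c := by rw [S.compat, S.add_assoc]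

theorem add_neg_cancel_left (a b : B) : S.add a (S.add (S.neg a) b) = b := by
  rw [← S.add_assoc, S.add_neg, S.zero_add]

theorem eq_neg_of_add {a b : B} (h : S.add a b = S.zero) : b = S.neg a := by
  rw [← S.neg_add_cancel_left a b, h, S.add_zero]

theorem eq_inv_of_mul {a b : B} (h : S.mul a b = S.zero) : b = S.inv a := by
  rw [← S.inv_mul_cancel_left a b, h, S.mul_zero]

theorem neg_neg (a : B) : S.neg (S.neg a) = a :=
  (S.eq_neg_of_add (S.neg_add a)).symm

theorem inv_inv (a : B) : S.inv (S.inv a) = a :=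
  (S.eq_inv_of_mul (S.inv_mul a)).symm

theorem neg_add_rev (a b : B) : S.neg (S.add a b) = S.add (S.neg b) (S.neg a) := by
  refine (S.eq_neg_of_add ?_).symm
  rw [S.add_assoc, S.add_neg_cancel_left, S.add_neg]

theorem mul_eq (a b : B) : S.mul a b = S.add a (S.lam a b) :=
  (S.add_neg_cancel_left a _).symm

theorem lam_add (a b c : B) : S.lam a (S.add b c) = S.add (S.lam a b) (S.lam a c) := by
  simp only [lam, S.compat, S.add_assoc]

theorem lam_zero (a : B) : S.lam a S.zero = S.zero := by
  rw [lam, S.mul_zero, S.neg_add]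

theorem zero_lam (a : B) : S.lam S.zero a = a := by
  rw [lam, S.zero_mul, S.neg_zero, S.zero_add]

theorem lam_neg (a b : B) : S.lam a (S.neg b) = S.neg (S.lam a b) :=
  S.eq_neg_of_add (by rw [← lam_add, S.add_neg, lam_zero])

theorem lam_mul (a b c : B) : S.lam (S.mul a b) c = S.lam a (S.lam b c) := by
  conv_rhs => rw [lam.eq_1 S b c]
  rw [lam_add, lam_neg]
  simp only [lam]
  rw [S.neg_add_rev, S.neg_neg, S.add_assoc, S.add_neg_cancel_left, S.mul_assoc]

theorem lam_inv_lam (a b : B) : S.lam (S.inv a) (S.lam a b) = b := by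
  rw [← lam_mul, S.inv_mul, zero_lam]

theorem lam_lam_inv (a b : B) : S.lam a (S.lam (S.inv a) b) = b := by
  rw [← lam_mul, S.mul_inv, zero_lam]

theorem add_eq (a b : B) : S.add a b = S.mul a (S.lam (S.inv a) b) := by
  rw [mul_eq, lam_lam_inv]

theorem inv_eq (a : B) : S.inv a = S.neg (S.lam (S.inv a) a) := by
  rw [lam, S.inv_mul, S.add_zero, S.neg_neg]

theorem lam_mul_rho (a b : B) : S.mul (S.lam a b) (S.rho b a) = S.mul a b := by
  rw [rho, S.mul_assoc, S.mul_inv_cancel_left]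

end SkewBrace

section Hom

variable {B : Type u} {C : Type v} {S : SkewBrace B} {T : SkewBrace C} {f : B → C}

theorem IsHom.map_zero_s16 (hf : IsHom S T f) : f S.zero = T.zero := by
  have h := T.inv_mul_cancel_left (f S.zero) (f S.zero)
  rwa [← hf.2, S.mul_zero, T.inv_mul, eq_comm] at h

theorem IsHom.map_neg_s16 (hf : IsHom S T f) (a : B) : f (S.neg a) = T.neg (f a) :=
  T.eq_neg_of_add (by rw [← hf.1, S.add_neg, hf.map_zero_s16])

theorem IsHom.map_inv_s16 (hf : IsHom S T f) (a : B) : f (S.inv a) = T.inv (f a) :=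
  T.eq_inv_of_mul (by rw [← hf.2, S.mul_inv, hf.map_zero_s16])

theorem IsHom.map_lam_s16 (hf : IsHom S T f) (a b : B) : f (S.lam a b) = T.lam (f a) (f b) := by
  rw [SkewBrace.lam, hf.1, hf.map_neg_s16, hf.2, SkewBrace.lam]

theorem IsIdeal.image (hf : IsHom S T f) (hs : Function.Surjective f) {I : Set B}
    (hI : IsIdeal S I) : IsIdeal T (f '' I) := by
  obtain ⟨h0, hadd, hneg, hmul, hinv, hnadd, hnmul, hlam⟩ := hI
  refine ⟨⟨_, h0, hf.map_zero_s16⟩, ?_, ?_, ?_, ?_, ?_, ?_, ?_⟩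
  · rintro _ ⟨a, ha, rfl⟩ _ ⟨b, hb, rfl⟩
    exact ⟨_, hadd a ha b hb, hf.1 a b⟩
  · rintro _ ⟨a, ha, rfl⟩
    exact ⟨_, hneg a ha, hf.map_neg_s16 a⟩
  · rintro _ ⟨a, ha, rfl⟩ _ ⟨b, hb, rfl⟩
    exact ⟨_, hmul a ha b hb, hf.2 a b⟩
  · rintro _ ⟨a, ha, rfl⟩
    exact ⟨_, hinv a ha, hf.map_inv_s16 a⟩
  · rintro b' _ ⟨a, ha, rfl⟩
    obtain ⟨b, rfl⟩ := hs b'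
    exact ⟨_, hnadd b a ha, by rw [hf.1, hf.1, hf.map_neg_s16]⟩
  · rintro b' _ ⟨a, ha, rfl⟩
    obtain ⟨b, rfl⟩ := hs b'
    exact ⟨_, hnmul b a ha, by rw [hf.2, hf.2, hf.map_inv_s16]⟩
  · intro b'
    obtain ⟨b, rfl⟩ := hs b'
    conv_rhs => rw [← hlam b]
    simp only [Set.image_image, hf.map_lam_s16]

end Hom

/-- A congruence of a skew brace: an equivalence relation compatible with both operations. -/
structure IsCongr {B : Type u} (S : SkewBrace B) (s : Setoid B) : Prop where
  add : ∀ {a a' b b'}, s a a' → s b b' → s (S.add a b) (S.add a' b')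
  mul : ∀ {a a' b b'}, s a a' → s b b' → s (S.mul a b) (S.mul a' b')

namespace IsCongr

variable {B : Type u} {C : Type v} {S : SkewBrace B} {T : SkewBrace C} {s s' : Setoid B}

theorem neg (hs : IsCongr S s) {a b : B} (h : s a b) : s (S.neg a) (S.neg b) := by
  have := hs.add (hs.add (s.refl (S.neg a)) (s.symm h)) (s.refl (S.neg b))
  rwa [S.add_assoc, S.add_neg, S.add_zero, S.neg_add, S.zero_add] at this

theorem inv (hs : IsCongr S s) {a b : B} (h : s a b) : s (S.inv a) (S.inv b) := by
  have := hs.mul (hs.mul (s.refl (S.inv a)) (s.symm h)) (s.refl (S.inv b))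
  rwa [S.mul_assoc, S.mul_inv, S.mul_zero, S.inv_mul, S.zero_mul] at this

theorem lam (hs : IsCongr S s) {a a' b b' : B} (ha : s a a') (hb : s b b') :
    s (S.lam a b) (S.lam a' b') :=
  hs.add (hs.neg ha) (hs.mul ha hb)

theorem op (hs : IsCongr S s) : IsCongr S.op s :=
  ⟨fun h h' => hs.add h' h, hs.mul⟩

theorem top : IsCongr S ⊤ := ⟨fun _ _ => trivial, fun _ _ => trivial⟩

theorem bot : IsCongr S ⊥ := ⟨fun h h' => congrArg₂ _ h h', fun h h' => congrArg₂ _ h h'⟩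

theorem inf (hs : IsCongr S s) (hs' : IsCongr S s') : IsCongr S (s ⊓ s') :=
  ⟨fun h h' => ⟨hs.add h.1 h'.1, hs'.add h.2 h'.2⟩,
    fun h h' => ⟨hs.mul h.1 h'.1, hs'.mul h.2 h'.2⟩⟩

theorem comap {q : Setoid C} (hq : IsCongr T q) {f : B → C} (hf : IsHom S T f) :
    IsCongr S (q.comap f) := by
  constructor <;> intro a a' b b' h h' <;> rw [Setoid.comap_rel] at *
  · rw [hf.1, hf.1]; exact hq.add h h'
  · rw [hf.2, hf.2]; exact hq.mul h h'

/-- The conjugate of an element congruent to `0` is congruent to `0`. -/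
theorem conj (hs : IsCongr S s) (b : B) {a : B} (h : s a S.zero) :
    s (S.mul (S.mul b a) (S.inv b)) S.zero := by
  have := hs.mul (hs.mul (s.refl b) h) (s.refl (S.inv b))
  rwa [S.mul_zero, S.mul_inv] at this

theorem isIdeal (hs : IsCongr S s) : IsIdeal S {a | s a S.zero} := by
  refine ⟨s.refl _, ?_, ?_, ?_, ?_, ?_, fun b a => hs.conj b, ?_⟩
  · intro a ha b hb
    simpa only [S.add_zero, Set.mem_ofPred_eq] using hs.add ha hb
  · intro a ha
    simpa only [S.neg_zero, Set.mem_ofPred_eq] using hs.neg ha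
  · intro a ha b hb
    simpa only [S.mul_zero, Set.mem_ofPred_eq] using hs.mul ha hb
  · intro a ha
    have := hs.inv ha
    rwa [← S.eq_inv_of_mul (S.zero_mul S.zero)] at this
  · intro b a ha
    have := hs.add (hs.add (s.refl b) ha) (s.refl (S.neg b))
    rwa [S.add_zero, S.add_neg] at this
  · intro b
    have key : ∀ b a, s a S.zero → s (S.lam b a) S.zero := fun b a ha => by
      simpa only [S.lam_zero] using hs.lam (s.refl b) ha
    ext a
    constructor
    · rintro ⟨c, hc, rfl⟩
      exact key b c hc
    · intro ha
      exact ⟨_, key (S.inv b) a ha, S.lam_lam_inv b a⟩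

/-- The quotient of a skew brace by a congruence. -/
def quotient (hs : IsCongr S s) : SkewBrace (Quotient s) where
  add := Quotient.map₂ S.add fun _ _ h _ _ h' => hs.add h h'
  zero := Quotient.mk s S.zero
  neg := Quotient.map S.neg fun _ _ h => hs.neg h
  mul := Quotient.map₂ S.mul fun _ _ h _ _ h' => hs.mul h h'
  inv := Quotient.map S.inv fun _ _ h => hs.inv h
  add_assoc := by
    rintro ⟨a⟩ ⟨b⟩ ⟨c⟩; exact congrArg (Quotient.mk s) (S.add_assoc a b c)
  zero_add := by rintro ⟨a⟩; exact congrArg (Quotient.mk s) (S.zero_add a)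
  add_zero := by rintro ⟨a⟩; exact congrArg (Quotient.mk s) (S.add_zero a)
  neg_add := by rintro ⟨a⟩; exact congrArg (Quotient.mk s) (S.neg_add a)
  add_neg := by rintro ⟨a⟩; exact congrArg (Quotient.mk s) (S.add_neg a)
  mul_assoc := by
    rintro ⟨a⟩ ⟨b⟩ ⟨c⟩; exact congrArg (Quotient.mk s) (S.mul_assoc a b c)
  zero_mul := by rintro ⟨a⟩; exact congrArg (Quotient.mk s) (S.zero_mul a)
  mul_zero := by rintro ⟨a⟩; exact congrArg (Quotient.mk s) (S.mul_zero a)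
  inv_mul := by rintro ⟨a⟩; exact congrArg (Quotient.mk s) (S.inv_mul a)
  mul_inv := by rintro ⟨a⟩; exact congrArg (Quotient.mk s) (S.mul_inv a)
  compat := by
    rintro ⟨a⟩ ⟨b⟩ ⟨c⟩; exact congrArg (Quotient.mk s) (S.compat a b c)

theorem isHom_mk (hs : IsCongr S s) : IsHom S hs.quotient (Quotient.mk s) :=
  ⟨fun _ _ => rfl, fun _ _ => rfl⟩

theorem brKer_mk (hs : IsCongr S s) :
    brKer hs.quotient (Quotient.mk s) = {a | s a S.zero} :=
  Set.ext fun _ => Quotient.eq (r := s)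

end IsCongr

/-- The congruence attached to an ideal. -/
def IsIdeal.setoid {B : Type u} {S : SkewBrace B} {I : Set B} (hI : IsIdeal S I) : Setoid B where
  r a b := ∃ i ∈ I, b = S.add a i
  iseqv := by
    obtain ⟨h0, hadd, hneg, -⟩ := hI
    refine ⟨fun a => ⟨_, h0, (S.add_zero a).symm⟩, ?_, ?_⟩
    · rintro a _ ⟨i, hi, rfl⟩
      exact ⟨_, hneg i hi, by rw [S.add_assoc, S.add_neg, S.add_zero]⟩
    · rintro a _ _ ⟨i, hi, rfl⟩ ⟨j, hj, rfl⟩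
      exact ⟨_, hadd i hi j hj, S.add_assoc a i j⟩

theorem IsIdeal.lam_mem {B : Type u} {S : SkewBrace B} {I : Set B} (hI : IsIdeal S I) (b : B)
    {a : B} (ha : a ∈ I) : S.lam b a ∈ I := by
  have h := hI.2.2.2.2.2.2.2 b
  rw [← h]
  exact ⟨a, ha, rfl⟩

theorem IsIdeal.isCongr {B : Type u} {S : SkewBrace B} {I : Set B} (hI : IsIdeal S I) :
    IsCongr S hI.setoid := by
  obtain ⟨_, hadd, _, _, _, hnadd, hnmul, _⟩ := id hI
  constructor
  · rintro a _ b _ ⟨i, hi, rfl⟩ ⟨j, hj, rfl⟩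
    refine ⟨_, hadd _ (hnadd (S.neg b) i hi) j hj, ?_⟩
    simp only [S.add_assoc, S.neg_neg, S.add_neg_cancel_left]
  · rintro a _ b _ ⟨i, hi, rfl⟩ ⟨j, hj, rfl⟩
    refine hI.setoid.trans' (y := S.mul a (S.add b j)) ?_ ?_
    · refine ⟨S.lam a j, hI.lam_mem a hj, ?_⟩
      rw [S.compat, S.add_assoc, SkewBrace.lam]
    · generalize S.add b j = y
      have hc := hnmul (S.inv y) _ (hI.lam_mem (S.inv a) hi)
      refine ⟨_, hI.lam_mem (S.mul a y) hc, ?_⟩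
      rw [← S.mul_eq, S.add_eq a i, S.inv_inv]
      simp only [S.mul_assoc, S.mul_inv_cancel_left]

/-- The section between the congruences `s` and `q` is an abelian skew brace. -/
def AbelianSection {B : Type u} (S : SkewBrace B) (s q : Setoid B) : Prop :=
  ∀ a b, s a S.zero → s b S.zero →
    q (S.mul a b) (S.add a b) ∧ q (S.add a b) (S.add b a)

/-- `s` is the last term of a finite descending chain of congruences with abelian sections
that starts at the total relation. -/
def IsSolubleCongr {B : Type u} (S : SkewBrace B) (s : Setoid B) : Prop :=
  ∃ (n : ℕ) (c : ℕ → Setoid B), (∀ k, IsCongr S (c k)) ∧ c 0 = ⊤ ∧ c n = s ∧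
    ∀ k < n, c (k + 1) ≤ c k ∧ AbelianSection S (c k) (c (k + 1))

namespace IsSolubleCongr

variable {B : Type u} {S : SkewBrace B} {s q : Setoid B}

theorem top : IsSolubleCongr S ⊤ :=
  ⟨0, fun _ => ⊤, fun _ => IsCongr.top, rfl, rfl, fun _ h => absurd h (Nat.not_lt_zero _)⟩

theorem isCongr (h : IsSolubleCongr S s) : IsCongr S s := by
  obtain ⟨n, c, hc, -, rfl, -⟩ := h
  exact hc n

theorem inf (h : IsSolubleCongr S s) (hq : IsCongr S q) (hab : AbelianSection S s q) :
    IsSolubleCongr S (s ⊓ q) := by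
  have hs := h.isCongr
  obtain ⟨n, c, hc, h0, hn, hstep⟩ := h
  refine ⟨n + 1, fun k => if k ≤ n then c k else s ⊓ q, fun k => ?_, by simpa using h0,
    by simp, fun k hk => ?_⟩
  · dsimp only
    split_ifs
    exacts [hc k, hs.inf hq]
  · rcases Nat.lt_succ_iff_lt_or_eq.mp hk with hk | rfl
    · simpa only [if_pos hk.le, if_pos (Nat.succ_le_of_lt hk)] using hstep k hk
    · simp only [le_refl, if_true, Nat.not_succ_le_self, if_false, hn]
      refine ⟨inf_le_left, fun a b ha hb => ?_⟩
      have hz : ∀ {x y}, s x S.zero → s y S.zero → s (S.add x y) S.zero := fun hx hy => by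
        simpa only [S.add_zero] using hs.add hx hy
      have hz' : s (S.mul a b) S.zero := by simpa only [S.mul_zero] using hs.mul ha hb
      exact ⟨⟨s.trans hz' (s.symm (hz ha hb)), (hab a b ha hb).1⟩,
        ⟨s.trans (hz ha hb) (s.symm (hz hb ha)), (hab a b ha hb).2⟩⟩

theorem isSoluble (h : IsSolubleCongr S ⊥) : IsSoluble S := by
  obtain ⟨n, c, hc, h0, hn, hstep⟩ := h
  refine ⟨n, fun k => Quotient (c k), fun k => (hc k).quotient, fun k => Quotient.mk (c k),
    fun k => ⟨(hc k).isHom_mk, Quotient.mk_surjective⟩, ?_, ?_, fun k => ?_, fun k => ?_⟩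
  · rw [IsCongr.brKer_mk, Fin.val_last, hn]
    rfl
  · rw [IsCongr.brKer_mk, Fin.val_zero, h0]
    rfl
  · rw [IsCongr.brKer_mk, IsCongr.brKer_mk]
    exact fun a ha => (hstep k k.2).1 ha
  · rw [IsCongr.brKer_mk]
    refine ⟨(hc _).isIdeal.image (hc _).isHom_mk Quotient.mk_surjective, ?_⟩
    rintro _ ⟨a, ha, rfl⟩ _ ⟨b, hb, rfl⟩
    have := (hstep k k.2).2 a b ha hb
    exact ⟨Quotient.sound this.1, Quotient.sound this.2⟩

end IsSolubleCongr

/-- The only multiplicative subgroup containing `R` is the whole skew brace. -/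
def MulGenerates {B : Type u} (S : SkewBrace B) (R : Set B) : Prop :=
  ∀ H : Set B, S.zero ∈ H → (∀ a ∈ H, ∀ b ∈ H, S.mul a b ∈ H) →
    (∀ a ∈ H, S.inv a ∈ H) → R ⊆ H → H = Set.univ

namespace MulGenerates

variable {B : Type u} {S : SkewBrace B} {R : Set B} {p q : Setoid B}

theorem lam_image (hR : MulGenerates S R) (h : ∀ a ∈ R, S.lam a '' R = R) (a : B) :
    S.lam a '' R = R := by
  refine Set.eq_univ_iff_forall.mp (hR {a | S.lam a '' R = R} ?_ ?_ ?_ h) a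
  · simp [SkewBrace.zero_lam]
  · intro a ha b hb
    change S.lam (S.mul a b) '' R = R
    simp only [SkewBrace.lam_mul]
    rw [← Set.image_image, hb, ha]
  · intro a ha
    change S.lam (S.inv a) '' R = R
    conv_lhs => rw [← ha]
    simp [Set.image_image, SkewBrace.lam_inv_lam]

/-- If `p` refines `q` on a `λ`-invariant generating set, then every element
`p`-congruent to `0` acts trivially modulo `q`. -/
theorem lam_rel (hR : MulGenerates S R) (h : ∀ a ∈ R, S.lam a '' R = R)
    (hp : IsCongr S p) (hq : IsCongr S q) (hpq : ∀ a ∈ R, ∀ b ∈ R, p a b → q a b)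
    {g : B} (hg : p g S.zero) (b : B) : q (S.lam g b) b := by
  have key : ∀ a b, (∀ g, p g S.zero → q (S.lam g b) b) →
      ∀ g, p g S.zero → q (S.lam g (S.lam a b)) (S.lam a b) := by
    intro a b hb g hg
    have hg' := hb _ (hp.conj (S.inv a) hg)
    have := hq.lam (q.refl a) hg'
    rwa [← S.lam_mul, S.inv_inv, S.mul_assoc, S.mul_inv_cancel_left, S.lam_mul] at this
  refine Set.eq_univ_iff_forall.mp
    (hR {b | ∀ g, p g S.zero → q (S.lam g b) b} ?_ ?_ ?_ ?_) b g hg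
  · intro g _
    rw [S.lam_zero]
  · intro a ha b hb g hg
    rw [S.mul_eq, S.lam_add]
    exact hq.add (ha g hg) (key a b hb g hg)
  · intro a ha g hg
    rw [S.inv_eq, S.lam_neg]
    exact hq.neg (key (S.inv a) a ha g hg)
  · intro b hb g hg
    refine hpq _ ?_ _ hb ?_
    · rw [← hR.lam_image h g]
      exact ⟨b, hb, rfl⟩
    · simpa only [S.zero_lam] using hp.lam hg (p.refl b)

theorem abelianSection (hR : MulGenerates S R) (h : ∀ a ∈ R, S.lam a '' R = R)
    (h' : ∀ a ∈ R, S.op.lam a '' R = R) (hp : IsCongr S p) (hq : IsCongr S q)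
    (hpq : ∀ a ∈ R, ∀ b ∈ R, p a b → q a b) : AbelianSection S p q := by
  intro a b ha _
  have hR' : MulGenerates S.op R := hR
  have h₁ := hq.add (q.refl a) (hR.lam_rel h hp hq hpq ha b)
  have h₂ := hq.op.add (q.refl a) (hR'.lam_rel h' hp.op hq.op hpq ha b)
  rw [← SkewBrace.mul_eq] at h₁ h₂
  exact ⟨h₁, q.trans (q.symm h₁) h₂⟩

end MulGenerates

namespace StructureBrace

variable {X : Type u} {r : X × X → X × X} (GX : StructureBrace r)

theorem map_r {x y z w : X} (h : r (x, y) = (z, w)) :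
    GX.S.lam (GX.ι x) (GX.ι y) = GX.ι z ∧
      GX.S.mul (GX.ι x) (GX.ι y) = GX.S.mul (GX.ι z) (GX.ι w) := by
  have hc := congrFun GX.compat (x, y)
  simp only [Function.comp_apply, Prod.map, h, SkewBrace.rB, Prod.mk.injEq] at hc
  exact ⟨hc.1.symm, by rw [hc.1, hc.2, GX.S.lam_mul_rho]⟩

theorem lam_image_range (hrn : Nondeg r) :
    ∀ a ∈ Set.range GX.ι, GX.S.lam a '' Set.range GX.ι = Set.range GX.ι := by
  rintro _ ⟨x, rfl⟩
  ext b
  constructor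
  · rintro ⟨_, ⟨y, rfl⟩, rfl⟩
    exact ⟨_, (GX.map_r (x := x) (y := y) rfl).1.symm⟩
  · rintro ⟨z, rfl⟩
    obtain ⟨y, rfl⟩ := (hrn.1 x).2 z
    exact ⟨_, ⟨y, rfl⟩, (GX.map_r (x := x) (y := y) rfl).1⟩

theorem op_lam_image_range (hr : IsSolution r) (hrn : Nondeg r) :
    ∀ a ∈ Set.range GX.ι, GX.S.op.lam a '' Set.range GX.ι = Set.range GX.ι := by
  have key : ∀ {x y z w}, r (z, w) = (x, y) → GX.S.op.lam (GX.ι x) (GX.ι y) = GX.ι z := by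
    intro x y z w h
    obtain ⟨h₁, h₂⟩ := GX.map_r h
    change GX.S.add (GX.S.mul (GX.ι x) (GX.ι y)) (GX.S.neg (GX.ι x)) = GX.ι z
    rw [← h₂, GX.S.mul_eq, h₁, GX.S.add_assoc, GX.S.add_neg, GX.S.add_zero]
  rintro _ ⟨x, rfl⟩
  ext b
  constructor
  · rintro ⟨_, ⟨y, rfl⟩, rfl⟩
    obtain ⟨⟨z, w⟩, h⟩ := hr.1.2 (x, y)
    exact ⟨z, (key h).symm⟩
  · rintro ⟨z, rfl⟩
    obtain ⟨w, hw⟩ := (hrn.1 z).2 x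
    exact ⟨_, ⟨(r (z, w)).2, rfl⟩, key (Prod.ext hw rfl)⟩

end StructureBrace

/-- The structure skew brace of a soluble non-degenerate solution
is a soluble skew brace. -/
theorem stmt_16 {X : Type u} (r : X × X → X × X) (hr : IsSolution r) (hrn : Nondeg r)
    (GX : StructureBrace r) (h : IsSolubleSolution r GX) :
    IsSoluble GX.S := by
  
  obtain ⟨t, C, T, f, Xk, hf, -, h0, -, hlast, hJ⟩ := h
  choose φ hφ hφι using fun k => (GX.univ (T k) (f k) (hf k).1).exists
  have hφι' : ∀ k x, φ k (GX.ι x) = f k x := fun k x => congrFun (hφι k) x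
  have hR : MulGenerates GX.S (Set.range GX.ι) := GX.gen
  have hker : ∀ k, IsCongr GX.S ((⊥ : Setoid (C k)).comap (φ k)) :=
    fun k => IsCongr.bot.comap (hφ k)
  have hab : ∀ k {q}, IsCongr GX.S q →
      (∀ x y, f k x = f k y → q (GX.ι x) (GX.ι y)) →
      AbelianSection GX.S ((⊥ : Setoid (C k)).comap (φ k)) q := by
    intro k q hq h
    refine hR.abelianSection (GX.lam_image_range hrn) (GX.op_lam_image_range hr hrn)
      (hker k) hq ?_
    rintro _ ⟨x, rfl⟩ _ ⟨y, rfl⟩ hxy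
    refine h x y ?_
    rw [← hφι', ← hφι']
    exact hxy
  have chain : ∀ k, ∃ s, IsSolubleCongr GX.S s ∧ s ≤ (⊥ : Setoid (C k)).comap (φ k) := by
    intro k
    induction k using Fin.induction with
    | zero =>
      refine ⟨⊤, .top, fun a b _ => ?_⟩
      obtain ⟨x, hx⟩ := (hf 0).2 (φ 0 a)
      obtain ⟨y, hy⟩ := (hf 0).2 (φ 0 b)
      change φ 0 a = φ 0 b
      rw [← hx, ← hy, h0 x y]
    | succ k ih =>
      obtain ⟨s, hs, hle⟩ := ih
      obtain ⟨J, ⟨hI, hJab⟩, -, hcos⟩ := hJ k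
      have hq := hI.isCongr.comap (hφ k.succ)
      have hs₁ := hs.inf hq fun a b ha hb => hab k.castSucc hq (fun x y hxy => by
        rw [Setoid.comap_rel, hφι', hφι']
        have hmem : f k.succ y ∈ lCoset (T k.succ) (f k.succ x) J := by
          rw [hcos x y hxy]
          exact ⟨_, hI.1, (T k.succ).mul_zero _⟩
        obtain ⟨j, hj, h⟩ := hmem
        exact ⟨_, hI.lam_mem _ hj, by rw [← SkewBrace.mul_eq]; exact h.symm⟩)
        a b (hle ha) (hle hb)
      refine ⟨_, hs₁.inf (hker k.succ) fun a b ha hb => ?_, inf_le_right⟩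
      have mem : ∀ {a}, hI.setoid (φ k.succ a) (φ k.succ GX.S.zero) → φ k.succ a ∈ J := by
        intro a ha
        obtain ⟨j, hj, h⟩ := hI.setoid.symm ha
        rw [(hφ k.succ).map_zero_s16, (T k.succ).zero_add] at h
        rwa [h]
      have hJ' := hJab _ (mem ha.2) _ (mem hb.2)
      rw [← (hφ k.succ).1, ← (hφ k.succ).1, ← (hφ k.succ).2] at hJ'
      exact hJ'
  obtain ⟨s, hs, hle⟩ := chain (Fin.last t)
  have := hs.inf IsCongr.bot fun a b ha hb =>
    hab (Fin.last t) IsCongr.bot hlast a b (hle ha) (hle hb)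
  rw [inf_bot_eq] at this
  exact this.isSoluble
end
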